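/- arXiv:math/0509077 — 3 statements merged into one kernel-verified Lean document; each statement's English description precedes it below -/
import Mathlib

section
/- (Beta-type oscillatory integral bound from Appendix A.2.) Let χ: ℝ → ℂ be a smooth compactly supported function that vanishes on a neighborhood of 0. Then for every k > 0 there exists a constant C_k > 0, depending only on τ, χ and k, such that for all purely imaginary λ: |B(λ, χ)| ≤ C_k·(1+|λ|)^{−k}. -/
open MeasureTheory

/-- `r ^ z := exp(z · log r)` for `r > 0` (junk value `exp 0 = 1` at `r = 0`). -/
noncomputable def rpowC (r : ℝ) (z : ℂ) : ℂ := Complex.exp (z * (Real.log r : ℂ))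

/-- The Beta-type oscillatory integral
`B(λ,χ) = ∫ |x+1|^{(−1−2τ+λ)/2}·|x−1|^{(−1+2τ+λ)/2}·χ(x) dx`. -/
noncomputable def betaInt (τ lam : ℂ) (χ : ℝ → ℂ) : ℂ :=
  ∫ x : ℝ, rpowC |x + 1| ((-1 - 2 * τ + lam) / 2) *
    rpowC |x - 1| ((-1 + 2 * τ + lam) / 2) * χ x

/-- Smooth compactly supported amplitudes vanishing in a neighbourhood of `0`. -/
structure IsAmplitude (χ : ℝ → ℂ) : Prop where
  contDiff : ContDiff ℝ (⊤ : ℕ∞) χ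
  hasCompactSupport : HasCompactSupport χ
  eventuallyEq_zero : χ =ᶠ[nhds 0] 0

theorem IsAmplitude.neg {f : ℝ → ℂ} (hf : IsAmplitude f) : IsAmplitude (-f) where
  contDiff := hf.contDiff.neg
  hasCompactSupport := hf.hasCompactSupport.neg
  eventuallyEq_zero := by
    filter_upwards [hf.eventuallyEq_zero] with x hx
    simp [hx]

theorem IsAmplitude.add {f g : ℝ → ℂ} (hf : IsAmplitude f) (hg : IsAmplitude g) :
    IsAmplitude (f + g) where
  contDiff := hf.contDiff.add hg.contDiff
  hasCompactSupport := hf.hasCompactSupport.add hg.hasCompactSupport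
  eventuallyEq_zero := by
    filter_upwards [hf.eventuallyEq_zero, hg.eventuallyEq_zero] with x hx hx'
    simp [hx, hx']

theorem IsAmplitude.mul_left {f g : ℝ → ℂ} (hf : ContDiff ℝ (⊤ : ℕ∞) f) (hg : IsAmplitude g) :
    IsAmplitude (f * g) where
  contDiff := hf.mul hg.contDiff
  hasCompactSupport := hg.hasCompactSupport.mul_left
  eventuallyEq_zero := by
    filter_upwards [hg.eventuallyEq_zero] with x hx
    simp [hx]

theorem IsAmplitude.deriv {f : ℝ → ℂ} (hf : IsAmplitude f) : IsAmplitude (deriv f) where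
  contDiff := (contDiff_infty_iff_deriv.1 hf.contDiff).2
  hasCompactSupport := hf.hasCompactSupport.deriv
  eventuallyEq_zero := by
    refine hf.eventuallyEq_zero.deriv.trans (Filter.Eventually.of_forall fun x => ?_)
    exact deriv_const x (0 : ℂ)

theorem contDiff_complexOfReal : ContDiff ℝ (⊤ : ℕ∞) (fun x : ℝ => (x : ℂ)) :=
  Complex.ofRealCLM.contDiff

/-- Since an amplitude vanishes near `0`, its quotient by the coordinate is an amplitude. -/
theorem IsAmplitude.div_id {f : ℝ → ℂ} (hf : IsAmplitude f) :
    IsAmplitude (fun x => (x : ℂ)⁻¹ * f x) where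
  contDiff := by
    rw [contDiff_iff_contDiffAt]
    intro x
    rcases eq_or_ne x 0 with rfl | hx
    · refine (contDiffAt_const (c := (0 : ℂ))).congr_of_eventuallyEq ?_
      filter_upwards [hf.eventuallyEq_zero] with x hx
      simp [hx]
    · exact (contDiff_complexOfReal.contDiffAt.inv (by exact_mod_cast hx)).mul
        hf.contDiff.contDiffAt
  hasCompactSupport := hf.hasCompactSupport.mul_left (f := fun x : ℝ => (x : ℂ)⁻¹)
  eventuallyEq_zero := by
    filter_upwards [hf.eventuallyEq_zero] with x hx
    simp [hx]

theorem norm_rpowC {r : ℝ} (hr : 0 < r) (z : ℂ) : ‖rpowC r z‖ = r ^ z.re := by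
  rw [rpowC, Complex.norm_exp, Real.rpow_def_of_pos hr, Complex.re_mul_ofReal, mul_comm]

theorem measurable_rpowC_abs (c : ℝ) (z : ℂ) : Measurable (fun x : ℝ => rpowC |x + c| z) := by
  unfold rpowC
  fun_prop

theorem hasDerivAt_mul_rpowC_abs {x : ℝ} (hx : x ≠ 0) (z : ℂ) :
    HasDerivAt (fun x : ℝ => (x : ℂ) * rpowC |x| z) ((1 + z) * rpowC |x| z) x := by
  simp only [rpowC, Real.log_abs]
  have h := (((Real.hasDerivAt_log hx).ofReal_comp).const_mul z).cexp
  have h' := ((hasDerivAt_id x).ofReal_comp).mul h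
  have hx' : (x : ℂ) ≠ 0 := by exact_mod_cast hx
  refine h'.congr_deriv ?_
  simp
  field_simp

theorem continuous_mul_rpowC_abs {z : ℂ} (hz : z.re = -1 / 2) :
    Continuous (fun x : ℝ => (x : ℂ) * rpowC |x| z) := by
  rw [continuous_iff_continuousAt]
  intro x
  rcases eq_or_ne x 0 with rfl | hx
  · have h : Filter.Tendsto (fun x : ℝ => |x| ^ (1 / 2 : ℝ)) (nhds 0) (nhds 0) := by
      have : Continuous (fun x : ℝ => |x| ^ (1 / 2 : ℝ)) :=
        continuous_abs.rpow_const fun _ => Or.inr (by norm_num)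
      simpa using this.tendsto 0
    rw [ContinuousAt]
    simp only [Complex.ofReal_zero, zero_mul]
    refine squeeze_zero_norm (fun x => ?_) h
    rcases eq_or_ne x 0 with rfl | hx
    · simp
    · have hx' := abs_pos.2 hx
      rw [norm_mul, norm_rpowC hx', Complex.norm_real, Real.norm_eq_abs, hz]
      nth_rewrite 1 [← Real.rpow_one |x|]
      rw [← Real.rpow_add hx']
      norm_num
  · exact (hasDerivAt_mul_rpowC_abs hx z).continuousAt

theorem intervalIntegrable_abs_rpow {r : ℝ} (hr : -1 < r) (c a b : ℝ) :
    IntervalIntegrable (fun x : ℝ => |x + c| ^ r) volume a b := by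
  have h := (intervalIntegral.intervalIntegrable_cpow' (r := (r : ℂ)) (a := a + c) (b := b + c)
    (by simpa using hr)).norm
  simp only [Complex.norm_cpow_real, Complex.norm_real, Real.norm_eq_abs] at h
  simpa using h.comp_add_right c

/-- An integrable majorant of the kernel of `betaInt` against a continuous amplitude. -/
theorem integrable_weight_mul {χ : ℝ → ℂ} (hc : Continuous χ) (hs : HasCompactSupport χ) :
    Integrable (fun x : ℝ => (|x + 1| ^ (-1 / 2 : ℝ) + |x + -1| ^ (-1 / 2 : ℝ)) * ‖χ x‖) := by
  obtain ⟨R, hR, hR'⟩ := hs.isCompact.isBounded.subset_ball_lt 0 0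
  have h : IntervalIntegrable
      (fun x : ℝ => (|x + 1| ^ (-1 / 2 : ℝ) + |x + -1| ^ (-1 / 2 : ℝ)) * ‖χ x‖) volume (-R) R :=
    ((intervalIntegrable_abs_rpow (by norm_num) 1 _ _).add
      (intervalIntegrable_abs_rpow (by norm_num) (-1) _ _)).mul_continuousOn hc.norm.continuousOn
  rw [intervalIntegrable_iff_integrableOn_Ioc_of_le (by linarith)] at h
  refine (integrableOn_iff_integrable_of_support_subset fun x hx => ?_).1 h
  have hx' : x ∈ Metric.ball (0 : ℝ) R := by
    refine hR' (subset_tsupport _ fun h0 => hx ?_)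
    simp [h0]
  rw [Metric.mem_ball, Real.dist_eq, sub_zero, abs_lt] at hx'
  exact ⟨hx'.1, hx'.2.le⟩

theorem norm_kernel_le {a b : ℂ} (ha : a.re = -1 / 2) (hb : b.re = -1 / 2) {x : ℝ}
    (h1 : x + 1 ≠ 0) (h2 : x + -1 ≠ 0) :
    ‖rpowC |x + 1| a * rpowC |x - 1| b‖ ≤ |x + 1| ^ (-1 / 2 : ℝ) + |x + -1| ^ (-1 / 2 : ℝ) := by
  rw [← sub_eq_add_neg] at h2 ⊢
  have p1 := abs_pos.2 h1
  have p2 := abs_pos.2 h2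
  rw [norm_mul, norm_rpowC p1, norm_rpowC p2, ha, hb]
  have q1 := Real.rpow_nonneg p1.le (-1 / 2)
  have q2 := Real.rpow_nonneg p2.le (-1 / 2)
  rcases le_total 0 x with hx | hx
  · have : |x + 1| ^ (-1 / 2 : ℝ) ≤ 1 :=
      Real.rpow_le_one_of_one_le_of_nonpos (by rw [abs_of_pos] <;> linarith) (by norm_num)
    nlinarith
  · have : |x - 1| ^ (-1 / 2 : ℝ) ≤ 1 :=
      Real.rpow_le_one_of_one_le_of_nonpos (by rw [abs_of_neg] <;> linarith) (by norm_num)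
    nlinarith

theorem norm_kernel_mul_ae_le {a b : ℂ} (ha : a.re = -1 / 2) (hb : b.re = -1 / 2) (χ : ℝ → ℂ) :
    ∀ᵐ x : ℝ, ‖rpowC |x + 1| a * rpowC |x - 1| b * χ x‖ ≤
      (|x + 1| ^ (-1 / 2 : ℝ) + |x + -1| ^ (-1 / 2 : ℝ)) * ‖χ x‖ := by
  filter_upwards [Measure.ae_ne volume (-1 : ℝ), Measure.ae_ne volume (1 : ℝ)] with x h1 h2
  rw [norm_mul]
  gcongr
  exact norm_kernel_le ha hb (fun h => h1 (by linarith)) (fun h => h2 (by linarith))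

theorem integrable_kernel_mul {a b : ℂ} (ha : a.re = -1 / 2) (hb : b.re = -1 / 2) {χ : ℝ → ℂ}
    (hc : Continuous χ) (hs : HasCompactSupport χ) :
    Integrable (fun x : ℝ => rpowC |x + 1| a * rpowC |x - 1| b * χ x) := by
  refine (integrable_weight_mul hc hs).mono' ?_ (norm_kernel_mul_ae_le ha hb χ)
  have h2 := measurable_rpowC_abs (-1) b
  simp only [← sub_eq_add_neg] at h2
  exact (((measurable_rpowC_abs 1 a).mul h2).mul hc.measurable).aestronglyMeasurable

/-- Integration by parts along the vector field `(x² - 1) d/dx`. -/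
theorem integral_kernel_eq_zero {a b : ℂ} (ha : a.re = -1 / 2) (hb : b.re = -1 / 2) {ψ : ℝ → ℂ}
    (hψ : ContDiff ℝ (⊤ : ℕ∞) ψ) (hs : HasCompactSupport ψ) :
    ∫ x : ℝ, rpowC |x + 1| a * rpowC |x - 1| b *
      (((1 + a) * (x - 1) + (1 + b) * (x + 1)) * ψ x + ((x : ℂ) ^ 2 - 1) * deriv ψ x) = 0 := by
  set g : ℝ → ℂ := fun x =>
    ((1 + a) * (x - 1) + (1 + b) * (x + 1)) * ψ x + ((x : ℂ) ^ 2 - 1) * deriv ψ x with hg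
  have hd : Continuous (deriv ψ) := hψ.continuous_deriv (by simp)
  have hgc : Continuous g := by
    have := hψ.continuous
    fun_prop
  have hgs : HasCompactSupport g :=
    (hs.mul_left (f := fun x : ℝ => (1 + a) * ((x : ℂ) - 1) + (1 + b) * (x + 1))).add
      (hs.deriv.mul_left (f := fun x : ℝ => (x : ℂ) ^ 2 - 1))
  have hint := integrable_kernel_mul ha hb hgc hgs
  obtain ⟨R, hR, hR'⟩ := (hs.isCompact.union hgs.isCompact).isBounded.subset_ball_lt 0 0
  have hsupp : ∀ x, (ψ x ≠ 0 ∨ g x ≠ 0) → x ∈ Set.Ioo (-R) R := fun x hx => by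
    have hx' : x ∈ Metric.ball (0 : ℝ) R :=
      hR' (hx.imp (fun h => subset_tsupport _ h) fun h => subset_tsupport _ h)
    rwa [Metric.mem_ball, Real.dist_eq, sub_zero, abs_lt] at hx'
  have hend : ∀ x, x ∉ Set.Ioo (-R) R → ψ x = 0 := fun x hx => by
    by_contra h
    exact hx (hsupp x (Or.inl h))
  rw [← intervalIntegral.integral_eq_integral_of_support_subset (a := -R) (b := R)]
  · rw [integral_eq_of_hasDerivAt_off_countable (s := {-1, 1})
      (fun x : ℝ => (((x + 1 : ℝ) : ℂ) * rpowC |x + 1| a) *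
        (((x - 1 : ℝ) : ℂ) * rpowC |x - 1| b) * ψ x) _ (Set.to_countable _) ?_ ?_
      hint.intervalIntegrable]
    · simp [hend R (by simp), hend (-R) (by simp)]
    · exact ((((continuous_mul_rpowC_abs ha).comp (continuous_id.add continuous_const)).mul
        ((continuous_mul_rpowC_abs hb).comp (continuous_id.sub continuous_const))).mul
        hψ.continuous).continuousOn
    · rintro x ⟨-, hx⟩
      simp only [Set.mem_insert_iff, Set.mem_singleton_iff, not_or] at hx
      have d1 := (hasDerivAt_mul_rpowC_abs (x := x + 1)
        (fun h => hx.1 (by linarith)) a).comp_add_const x 1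
      have d2 := (hasDerivAt_mul_rpowC_abs (x := x - 1)
        (fun h => hx.2 (by linarith)) b).comp_sub_const x 1
      have d3 := (hψ.differentiable (by simp) x).hasDerivAt
      refine ((d1.mul d2).mul d3).congr_deriv ?_
      simp only [hg, Pi.mul_apply]
      push_cast
      ring
  · intro x hx
    have := hsupp x (Or.inr fun h => hx (mul_eq_zero_of_right _ h))
    exact ⟨this.1, this.2.le⟩

/-- One integration by parts gains a factor `λ - 1`. -/
theorem IsAmplitude.exists_sub_one_mul_betaInt {τ : ℂ} (hτ : τ.re = 0) {χ : ℝ → ℂ}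
    (hχ : IsAmplitude χ) :
    ∃ φ : ℝ → ℂ, IsAmplitude φ ∧
      ∀ lam : ℂ, lam.re = 0 → (lam - 1) * betaInt τ lam χ = betaInt τ lam φ := by
  set ψ : ℝ → ℂ := fun x => (x : ℂ)⁻¹ * χ x with hψdef
  have hψ : IsAmplitude ψ := hχ.div_id
  have hxψ : ∀ x : ℝ, (x : ℂ) * ψ x = χ x := fun x => by
    rcases eq_or_ne x 0 with rfl | hx
    · simp [hχ.eventuallyEq_zero.self_of_nhds]
    · have : (x : ℂ) ≠ 0 := by exact_mod_cast hx
      simp [hψdef, this]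
  have hφ : IsAmplitude (-((fun x : ℝ => 2 * (x : ℂ) + 2 * τ) * ψ +
      (fun x : ℝ => (x : ℂ) ^ 2 - 1) * _root_.deriv ψ)) :=
    ((hψ.mul_left ((contDiff_const.mul contDiff_complexOfReal).add contDiff_const)).add
      (hψ.deriv.mul_left ((contDiff_complexOfReal.pow 2).sub contDiff_const))).neg
  refine ⟨_, hφ, fun lam hlam => ?_⟩
  have ha : ((-1 - 2 * τ + lam) / 2).re = -1 / 2 := by simp [hτ, hlam]
  have hb : ((-1 + 2 * τ + lam) / 2).re = -1 / 2 := by simp [hτ, hlam]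
  have key := integral_kernel_eq_zero ha hb hψ.contDiff hψ.hasCompactSupport
  rw [← sub_eq_zero, ← key, betaInt, betaInt, ← integral_const_mul, ← integral_sub]
  · congr 1 with x
    simp only [Pi.neg_apply, Pi.add_apply, Pi.mul_apply, ← hxψ x]
    ring
  · exact (integrable_kernel_mul ha hb hχ.contDiff.continuous hχ.hasCompactSupport).const_mul _
  · exact integrable_kernel_mul ha hb hφ.contDiff.continuous hφ.hasCompactSupport

theorem IsAmplitude.exists_pow_mul_norm_betaInt_le {τ : ℂ} (hτ : τ.re = 0) (n : ℕ) :
    ∀ {χ : ℝ → ℂ}, IsAmplitude χ →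
      ∃ M : ℝ, ∀ lam : ℂ, lam.re = 0 → ‖lam - 1‖ ^ n * ‖betaInt τ lam χ‖ ≤ M := by
  induction n with
  | zero =>
    intro χ hχ
    refine ⟨∫ x : ℝ, (|x + 1| ^ (-1 / 2 : ℝ) + |x + -1| ^ (-1 / 2 : ℝ)) * ‖χ x‖,
      fun lam hlam => ?_⟩
    rw [pow_zero, one_mul]
    exact norm_integral_le_of_norm_le
      (integrable_weight_mul hχ.contDiff.continuous hχ.hasCompactSupport)
      (norm_kernel_mul_ae_le (by simp [hτ, hlam]) (by simp [hτ, hlam]) χ)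
  | succ n ih =>
    intro χ hχ
    obtain ⟨φ, hφ, h⟩ := hχ.exists_sub_one_mul_betaInt hτ
    obtain ⟨M, hM⟩ := ih hφ
    refine ⟨M, fun lam hlam => ?_⟩
    rw [pow_succ, mul_assoc, ← norm_mul, h lam hlam]
    exact hM lam hlam

theorem one_add_norm_le_two_mul_norm_sub_one {lam : ℂ} (h : lam.re = 0) :
    1 + ‖lam‖ ≤ 2 * ‖lam - 1‖ := by
  have h1 : 1 ≤ ‖lam - 1‖ := by simpa [h] using Complex.abs_re_le_norm (lam - 1)
  have h2 : ‖lam‖ ≤ ‖lam - 1‖ := by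
    have := Complex.abs_im_le_norm (lam - 1)
    rwa [Complex.sub_im, Complex.one_im, sub_zero, Complex.abs_im_eq_norm.2 h] at this
  linarith

/-- Appendix A.2: for a smooth compactly supported amplitude vanishing near the
stationary point `x = 0`, the Beta-type integral decays faster than any power of `|λ|`. -/
theorem beta_integral_rapid_decay
    (τ : ℂ) (hτ : τ.re = 0)
    (χ : ℝ → ℂ) (hχ_smooth : ContDiff ℝ (⊤ : ℕ∞) χ) (hχ_cpt : HasCompactSupport χ)
    (hχ_van : ∃ δ : ℝ, 0 < δ ∧ ∀ x : ℝ, |x| < δ → χ x = 0) :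
    ∀ k : ℝ, 0 < k → ∃ Ck : ℝ, 0 < Ck ∧ ∀ lam : ℂ, lam.re = 0 →
      ‖betaInt τ lam χ‖ ≤ Ck * (1 + ‖lam‖) ^ (-k) := by
  intro k _
  have hχ : IsAmplitude χ := ⟨hχ_smooth, hχ_cpt, by
    obtain ⟨δ, hδ, h⟩ := hχ_van
    filter_upwards [Metric.ball_mem_nhds (0 : ℝ) hδ] with x hx
    exact h x (by simpa using hx)⟩
  obtain ⟨n, hn⟩ := exists_nat_ge k
  obtain ⟨M, hM⟩ := hχ.exists_pow_mul_norm_betaInt_le hτ n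
  refine ⟨2 ^ n * max M 1, by positivity, fun lam hlam => ?_⟩
  have hpos : 1 ≤ 1 + ‖lam‖ := by linarith [norm_nonneg lam]
  have hpow : 0 < (1 + ‖lam‖) ^ k := Real.rpow_pos_of_pos (by linarith) k
  rw [Real.rpow_neg (by linarith), ← div_eq_mul_inv, le_div_iff₀ hpow, mul_comm]
  calc (1 + ‖lam‖) ^ k * ‖betaInt τ lam χ‖
      ≤ (1 + ‖lam‖) ^ n * ‖betaInt τ lam χ‖ := by
        gcongr
        rw [← Real.rpow_natCast]
        exact Real.rpow_le_rpow_of_exponent_le hpos hn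
    _ ≤ (2 * ‖lam - 1‖) ^ n * ‖betaInt τ lam χ‖ := by
        gcongr
        exact one_add_norm_le_two_mul_norm_sub_one hlam
    _ = 2 ^ n * (‖lam - 1‖ ^ n * ‖betaInt τ lam χ‖) := by rw [mul_pow, mul_assoc]
    _ ≤ 2 ^ n * max M 1 := by
        gcongr
        exact (hM lam hlam).trans (le_max_left _ _)
end

section
/- (Uniform bound for the scaled J⁻-integral from Appendix A.2.) Fix k ∈ ℕ and M ≥ 1. There exist n = n(k) ∈ ℕ and C = C(k, M) > 0 with the following property. Let f: [1/4, 1] → ℝ be a smooth function with f(1) = 0, f'(x) ≥ 1 for all x ∈ [1/4, 1], and |f^{(j)}(x)| ≤ M for all x ∈ [1/4, 1] and all 1 ≤ j ≤ n. Let ψ: [1/4, 1] → ℂ be a smooth function with |ψ^{(j)}(x)| ≤ M for all x ∈ [1/4, 1] and all 0 ≤ j ≤ n, and with ψ^{(j)}(1/4) = 0 for all 0 ≤ j ≤ n. Then for every purely imaginary λ with |λ| ≥ 1: |∫_{1/4}^{1} |f(x)|^{(λ−1)/2}·ψ(x) dx| ≤ C·|λ|^{−k}. (Note that since f(1) = 0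 and f' ≥ 1, the function f is negative on [1/4, 1) and the integrand, with r^z := exp(z·log r) for r > 0, has an absolutely integrable singularity at x = 1.) -/
open MeasureTheory

section Quotient

variable {S : Set ℝ} {h : ℝ → ℝ} {u : ℝ → ℂ}

theorem smul_iteratedDerivWithin_eq_sub_sum (hS : UniqueDiffOn ℝ S) {n : ℕ}
    (hh : ContDiffOn ℝ n h S) (hu : ContDiffOn ℝ n u S) {x : ℝ} (hx : x ∈ S) :
    h x • iteratedDerivWithin n u S x = iteratedDerivWithin n (h • u) S x -
      ∑ i ∈ Finset.range n, n.choose (i + 1) •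
        iteratedDerivWithin (i + 1) h S x • iteratedDerivWithin (n - (i + 1)) u S x := by
  rw [iteratedDerivWithin_smul hx hS (hh x hx) (hu x hx), Finset.sum_range_succ']
  simp

/-- Derivatives of a quotient `u = (h • u) / h` with `h ≥ 1` are bounded in terms of bounds on
the derivatives of `h` and `h • u`. -/
theorem exists_norm_iteratedDerivWithin_le_of_smul (hS : UniqueDiffOn ℝ S) (M : ℝ) (hM : 0 ≤ M)
    (n : ℕ) : ∃ B : ℝ, 0 ≤ B ∧ ∀ (h : ℝ → ℝ) (u : ℝ → ℂ),
      ContDiffOn ℝ n h S → ContDiffOn ℝ n u S → (∀ x ∈ S, 1 ≤ h x) →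
      (∀ j ≤ n, ∀ x ∈ S, |iteratedDerivWithin j h S x| ≤ M) →
      (∀ j ≤ n, ∀ x ∈ S, ‖iteratedDerivWithin j (h • u) S x‖ ≤ M) →
      ∀ j ≤ n, ∀ x ∈ S, ‖iteratedDerivWithin j u S x‖ ≤ B := by
  induction n with
  | zero =>
    refine ⟨M, hM, fun h u hh hu h1 _ hψ j hj x hx ↦ ?_⟩
    obtain rfl : j = 0 := by omega
    have h2 := hψ 0 le_rfl x hx
    simp only [iteratedDerivWithin_zero, Pi.smul_apply', norm_smul] at h2 ⊢
    refine le_trans ?_ h2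
    exact le_mul_of_one_le_left (norm_nonneg _) ((h1 x hx).trans (le_abs_self _))
  | succ n ih =>
    obtain ⟨B, hB, ih⟩ := ih
    have hsum : 0 ≤ ∑ i ∈ Finset.range (n + 1), ((n + 1).choose (i + 1) : ℝ) * (M * B) :=
      Finset.sum_nonneg fun i _ ↦ by positivity
    refine ⟨max B (M + ∑ i ∈ Finset.range (n + 1), ((n + 1).choose (i + 1) : ℝ) * (M * B)),
      le_max_of_le_left hB, fun h u hh hu h1 hb hψ j hj x hx ↦ ?_⟩
    have hle : (n : WithTop ℕ∞) ≤ (n + 1 : ℕ) := by exact_mod_cast n.le_succ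
    have ih' := ih h u (hh.of_le hle) (hu.of_le hle) h1 (fun j hj ↦ hb j (by omega))
      (fun j hj ↦ hψ j (by omega))
    rcases Nat.lt_or_ge n j with hnj | hnj
    · obtain rfl : j = n + 1 := by omega
      refine le_max_of_le_right ?_
      calc ‖iteratedDerivWithin (n + 1) u S x‖
          ≤ ‖h x • iteratedDerivWithin (n + 1) u S x‖ := by
            rw [norm_smul]
            exact le_mul_of_one_le_left (norm_nonneg _) ((h1 x hx).trans (le_abs_self _))
        _ ≤ _ := by
            rw [smul_iteratedDerivWithin_eq_sub_sum hS hh hu hx]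
            refine (norm_sub_le _ _).trans (add_le_add (hψ _ le_rfl x hx) ?_)
            refine norm_sum_le_of_le _ fun i hi ↦ ?_
            rw [Finset.mem_range] at hi
            rw [nsmul_eq_mul, norm_mul, norm_smul, Complex.norm_natCast]
            have := hb (i + 1) (by omega) x hx
            have := ih' (n + 1 - (i + 1)) (by omega) x hx
            rw [Real.norm_eq_abs]
            gcongr
    · exact le_max_of_le_left (ih' j hnj x hx)

theorem iteratedDerivWithin_eq_zero_of_smul (hS : UniqueDiffOn ℝ S) {n : ℕ}
    (hh : ContDiffOn ℝ n h S) (hu : ContDiffOn ℝ n u S) {x : ℝ} (hx : x ∈ S) (h0 : h x ≠ 0)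
    (hψ : ∀ j ≤ n, iteratedDerivWithin j (h • u) S x = 0) :
    ∀ j ≤ n, iteratedDerivWithin j u S x = 0 := by
  intro j
  induction j using Nat.strong_induction_on with
  | _ j ih =>
    intro hj
    have hle : (j : WithTop ℕ∞) ≤ n := by exact_mod_cast hj
    have key := smul_iteratedDerivWithin_eq_sub_sum hS (hh.of_le hle) (hu.of_le hle) hx
    rw [hψ j hj, Finset.sum_eq_zero, sub_zero] at key
    · exact (smul_eq_zero.1 key).resolve_left h0
    · intro i hi
      rw [Finset.mem_range] at hi
      rw [ih (j - (i + 1)) (by omega) (by omega), smul_zero, smul_zero]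

end Quotient

section Oscillatory

open Set

variable {a b M : ℝ} {f : ℝ → ℝ}

theorem hasDerivAt_derivWithin_Icc {E : Type*} [NormedAddCommGroup E] [NormedSpace ℝ E]
    {g : ℝ → E} (hg : DifferentiableOn ℝ g (Icc a b)) {x : ℝ} (hx : x ∈ Ioo a b) :
    HasDerivAt g (derivWithin g (Icc a b) x) x :=
  (hg x (Ioo_subset_Icc_self hx)).hasDerivWithinAt.hasDerivAt (Icc_mem_nhds hx.1 hx.2)

theorem sub_le_neg_of_one_le_derivWithin (hf : DifferentiableOn ℝ f (Icc a b)) (hfb : f b = 0)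
    (hf1 : ∀ x ∈ Icc a b, 1 ≤ derivWithin f (Icc a b) x) {x : ℝ} (hx : x ∈ Icc a b) :
    b - x ≤ -f x := by
  have := (convex_Icc a b).mul_sub_le_image_sub_of_le_deriv hf.continuousOn
    (hf.mono interior_subset) (C := 1) (fun y hy ↦ by
      rw [interior_Icc] at hy
      rw [(hasDerivAt_derivWithin_Icc hf hy).deriv]
      exact hf1 y (Ioo_subset_Icc_self hy)) x hx b (right_mem_Icc.2 (hx.1.trans hx.2)) hx.2
  linarith

theorem neg_le_mul_sub_of_derivWithin_le (hf : DifferentiableOn ℝ f (Icc a b)) (hfb : f b = 0)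
    (hfM : ∀ x ∈ Icc a b, derivWithin f (Icc a b) x ≤ M) {x : ℝ} (hx : x ∈ Icc a b) :
    -f x ≤ M * (b - x) := by
  have := (convex_Icc a b).image_sub_le_mul_sub_of_deriv_le hf.continuousOn
    (hf.mono interior_subset) (C := M) (fun y hy ↦ by
      rw [interior_Icc] at hy
      rw [(hasDerivAt_derivWithin_Icc hf hy).deriv]
      exact hfM y (Ioo_subset_Icc_self hy)) x hx b (right_mem_Icc.2 (hx.1.trans hx.2)) hx.2
  linarith

theorem Real.rpow_le_one_add_rpow_mul_rpow {s t : ℝ} (p : ℝ) (hM : 0 ≤ M) (ht : 0 < t)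
    (hts : t ≤ s) (hs : s ≤ M * t) : s ^ p ≤ (1 + M ^ p) * t ^ p := by
  have h1 : 0 ≤ t ^ p := Real.rpow_nonneg ht.le p
  have h2 : 0 ≤ M ^ p := Real.rpow_nonneg hM p
  rcases le_total 0 p with hp | hp
  · have := Real.rpow_le_rpow (ht.le.trans hts) hs hp
    rw [Real.mul_rpow hM ht.le] at this
    linarith
  · have := Real.rpow_le_rpow_of_nonpos ht hts hp
    nlinarith

theorem norm_cpow_mul_le (hM : 0 ≤ M) (hf : DifferentiableOn ℝ f (Icc a b)) (hfb : f b = 0)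
    (hf1 : ∀ x ∈ Icc a b, 1 ≤ derivWithin f (Icc a b) x)
    (hfM : ∀ x ∈ Icc a b, derivWithin f (Icc a b) x ≤ M)
    {φ : ℝ → ℂ} {K : ℝ} (hφ : ∀ x ∈ Icc a b, ‖φ x‖ ≤ K) (z : ℂ) {x : ℝ} (hx : x ∈ Ioo a b) :
    ‖((-f x : ℝ) : ℂ) ^ z * φ x‖ ≤ (1 + M ^ z.re) * (b - x) ^ z.re * K := by
  have hx' := Ioo_subset_Icc_self hx
  have h0 : 0 < b - x := sub_pos.2 hx.2
  have h1 := sub_le_neg_of_one_le_derivWithin hf hfb hf1 hx'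
  have h2 := neg_le_mul_sub_of_derivWithin_le hf hfb hfM hx'
  rw [norm_mul, Complex.norm_cpow_eq_rpow_re_of_pos (h0.trans_le h1)]
  have := Real.rpow_le_one_add_rpow_mul_rpow z.re hM h0 h1 h2
  exact mul_le_mul this (hφ x hx') (norm_nonneg _)
    ((Real.rpow_nonneg (h0.le.trans h1) _).trans this)

theorem intervalIntegrable_sub_rpow {p : ℝ} (hp : -1 < p) (c d : ℝ) :
    IntervalIntegrable (fun x ↦ c * (b - x) ^ p * d) volume a b := by
  have := (intervalIntegral.intervalIntegrable_rpow' (a := b - a) (b := b - b) hp).comp_sub_left b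
  simp only [sub_sub_cancel] at this
  exact (this.const_mul c).mul_const d

theorem ae_mem_Ioo_restrict_uIoc (hab : a ≤ b) :
    ∀ᵐ x ∂volume.restrict (uIoc a b), x ∈ Ioo a b := by
  rw [uIoc_of_le hab, ← restrict_Ioo_eq_restrict_Ioc]
  exact ae_restrict_mem measurableSet_Ioo

theorem intervalIntegrable_cpow_mul (hab : a ≤ b) (hM : 0 ≤ M)
    (hf : DifferentiableOn ℝ f (Icc a b)) (hfb : f b = 0)
    (hf1 : ∀ x ∈ Icc a b, 1 ≤ derivWithin f (Icc a b) x)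
    (hfM : ∀ x ∈ Icc a b, derivWithin f (Icc a b) x ≤ M)
    {φ : ℝ → ℂ} (hφ : ContinuousOn φ (Icc a b)) {z : ℂ} (hz : -1 < z.re) :
    IntervalIntegrable (fun x ↦ ((-f x : ℝ) : ℂ) ^ z * φ x) volume a b := by
  obtain ⟨K, hK⟩ := isCompact_Icc.exists_bound_of_continuousOn hφ
  refine (intervalIntegrable_sub_rpow hz (1 + M ^ z.re) K).mono_fun' ?_ ?_
  · rw [uIoc_of_le hab, ← restrict_Ioo_eq_restrict_Ioc]
    refine ContinuousOn.aestronglyMeasurable (fun x hx ↦ ?_) measurableSet_Ioo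
    have hx' := Ioo_subset_Icc_self hx
    have hpos : 0 < -f x :=
      (sub_pos.2 hx.2).trans_le (sub_le_neg_of_one_le_derivWithin hf hfb hf1 hx')
    exact ((Complex.continuousAt_ofReal_cpow_const (-f x) z
      (Or.inr hpos.ne')).comp_continuousWithinAt (f := fun y ↦ -f y)
      ((hf.continuousOn x hx').mono Ioo_subset_Icc_self).neg).mul
      ((hφ x hx').mono Ioo_subset_Icc_self)
  · filter_upwards [ae_mem_Ioo_restrict_uIoc hab] with x hx
    exact norm_cpow_mul_le hM hf hfb hf1 hfM hK z hx

theorem norm_integral_cpow_mul_le (hab : a ≤ b) (hM : 0 ≤ M)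
    (hf : DifferentiableOn ℝ f (Icc a b)) (hfb : f b = 0)
    (hf1 : ∀ x ∈ Icc a b, 1 ≤ derivWithin f (Icc a b) x)
    (hfM : ∀ x ∈ Icc a b, derivWithin f (Icc a b) x ≤ M)
    {φ : ℝ → ℂ} {K : ℝ} (hφ : ∀ x ∈ Icc a b, ‖φ x‖ ≤ K) {z : ℂ} (hz : -1 < z.re) :
    ‖∫ x in a..b, ((-f x : ℝ) : ℂ) ^ z * φ x‖ ≤
      ∫ x in a..b, (1 + M ^ z.re) * (b - x) ^ z.re * K := by
  refine intervalIntegral.norm_integral_le_of_norm_le hab ?_ (intervalIntegrable_sub_rpow hz _ _)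
  rw [← ae_restrict_iff' measurableSet_Ioc, ← uIoc_of_le hab]
  filter_upwards [ae_mem_Ioo_restrict_uIoc hab] with x hx
  exact norm_cpow_mul_le hM hf hfb hf1 hfM hφ z hx

/-- Integration by parts against `(-f) ^ z`: the boundary term at `b` vanishes because
`f b = 0`, the one at `a` because `u a = 0`. -/
theorem mul_integral_cpow_mul_derivWithin_smul (hab : a < b) (hM : 0 ≤ M)
    (hf : ContDiffOn ℝ 1 f (Icc a b)) (hfb : f b = 0)
    (hf1 : ∀ x ∈ Icc a b, 1 ≤ derivWithin f (Icc a b) x)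
    (hfM : ∀ x ∈ Icc a b, derivWithin f (Icc a b) x ≤ M)
    {u : ℝ → ℂ} (hu : ContDiffOn ℝ 1 u (Icc a b)) (hua : u a = 0) {z : ℂ} (hz : -1 < z.re) :
    (z + 1) * ∫ x in a..b, ((-f x : ℝ) : ℂ) ^ z * (derivWithin f (Icc a b) x • u x) =
      ∫ x in a..b, ((-f x : ℝ) : ℂ) ^ (z + 1) * derivWithin u (Icc a b) x := by
  have hS := uniqueDiffOn_Icc hab
  have hfd := hf.differentiableOn one_ne_zero
  have hud := hu.differentiableOn one_ne_zero
  have hz1 : 0 < (z + 1).re := by simp; linarith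
  have hz0 : z + 1 ≠ 0 := fun h ↦ by simp [h] at hz1
  have hI1 := intervalIntegrable_cpow_mul hab.le hM hfd hfb hf1 hfM
    (φ := fun x ↦ derivWithin f (Icc a b) x • u x)
    ((hf.continuousOn_derivWithin hS le_rfl).smul hu.continuousOn) hz
  have hI2 := intervalIntegrable_cpow_mul hab.le hM hfd hfb hf1 hfM
    (hu.continuousOn_derivWithin hS le_rfl) (z := z + 1) (by linarith)
  have hcont : ContinuousOn (fun x ↦ ((-f x : ℝ) : ℂ) ^ (z + 1) * u x) (Icc a b) :=
    ((Complex.continuous_ofReal_cpow_const hz1).comp_continuousOn hf.continuousOn.neg).mul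
      hu.continuousOn
  have hderiv : ∀ x ∈ Ioo a b, HasDerivAt (fun x ↦ ((-f x : ℝ) : ℂ) ^ (z + 1) * u x)
      (((-f x : ℝ) : ℂ) ^ (z + 1) * derivWithin u (Icc a b) x -
        (z + 1) * (((-f x : ℝ) : ℂ) ^ z * (derivWithin f (Icc a b) x • u x))) x := by
    intro x hx
    have hpos : 0 < -f x := (sub_pos.2 hx.2).trans_le
      (sub_le_neg_of_one_le_derivWithin hfd hfb hf1 (Ioo_subset_Icc_self hx))
    have h1 := (hasDerivAt_ofReal_cpow_const hpos.ne' hz0).scomp x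
      (hasDerivAt_derivWithin_Icc hfd hx).fun_neg
    refine (h1.mul (hasDerivAt_derivWithin_Icc hud hx)).congr_deriv ?_
    simp only [Function.comp, add_sub_cancel_right, Complex.real_smul]
    push_cast
    ring
  have key := intervalIntegral.integral_eq_sub_of_hasDerivAt_of_le hab.le hcont hderiv
    (hI2.sub (hI1.const_mul (z + 1)))
  rw [intervalIntegral.integral_sub hI2 (hI1.const_mul (z + 1)),
    intervalIntegral.integral_const_mul] at key
  simp only [hfb, hua, neg_zero, Complex.ofReal_zero, Complex.zero_cpow hz0, mul_zero, zero_mul,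
    sub_zero] at key
  exact (sub_eq_zero.1 key).symm

/-- Rapid decay in `Im z` of `∫ (-f) ^ z * ψ` at fixed `Re z = p > -1`, uniformly in the phase `f`
and the amplitude `ψ`. -/
theorem exists_norm_integral_cpow_mul_le (hab : a < b) (k : ℕ) : ∀ (M : ℝ), 0 ≤ M → ∀ p : ℝ,
    -1 < p → ∃ C : ℝ, ∀ (f : ℝ → ℝ) (ψ : ℝ → ℂ), ContDiffOn ℝ (k + 1 : ℕ) f (Icc a b) → f b = 0 →
      (∀ x ∈ Icc a b, 1 ≤ derivWithin f (Icc a b) x) →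
      (∀ j, 1 ≤ j → j ≤ k + 1 → ∀ x ∈ Icc a b, |iteratedDerivWithin j f (Icc a b) x| ≤ M) →
      ContDiffOn ℝ k ψ (Icc a b) →
      (∀ j ≤ k, ∀ x ∈ Icc a b, ‖iteratedDerivWithin j ψ (Icc a b) x‖ ≤ M) →
      (∀ j ≤ k, iteratedDerivWithin j ψ (Icc a b) a = 0) →
      ∀ z : ℂ, z.re = p → ‖∫ x in a..b, ((-f x : ℝ) : ℂ) ^ z * ψ x‖ * |z.im| ^ k ≤ C := by
  have hS := uniqueDiffOn_Icc hab
  induction k with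
  | zero =>
    intro M hM p hp
    refine ⟨∫ x in a..b, (1 + M ^ p) * (b - x) ^ p * M, ?_⟩
    intro f ψ hf hfb hf1 hfM _ hψM _ z hz
    subst hz
    rw [pow_zero, mul_one]
    refine norm_integral_cpow_mul_le hab.le hM (hf.differentiableOn (by simp)) hfb hf1
      (fun x hx ↦ ?_) (fun x hx ↦ by simpa using hψM 0 le_rfl x hx) hp
    exact (le_abs_self _).trans (by simpa using hfM 1 le_rfl le_rfl x hx)
  | succ k ih =>
    intro M hM p hp
    obtain ⟨B, hB, hquot⟩ := exists_norm_iteratedDerivWithin_le_of_smul hS M hM (k + 1)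
    obtain ⟨C, ih⟩ := ih (max M B) (le_max_of_le_left hM) (p + 1) (by linarith)
    refine ⟨C, fun f ψ hf hfb hf1 hfM hψ hψM hψa z hz ↦ ?_⟩
    set h := derivWithin f (Icc a b) with hh_def
    set u : ℝ → ℂ := fun x ↦ (h x)⁻¹ • ψ x with hu_def
    have h0 : ∀ x ∈ Icc a b, h x ≠ 0 := fun x hx ↦ (one_pos.trans_le (hf1 x hx)).ne'
    have hh : ContDiffOn ℝ (k + 1 : ℕ) h (Icc a b) := hf.derivWithin hS (by norm_cast)
    have hu : ContDiffOn ℝ (k + 1 : ℕ) u (Icc a b) := (hh.inv h0).smul hψ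
    have hhu : EqOn (h • u) ψ (Icc a b) := fun x hx ↦ by
      simp [hu_def, h0 x hx]
    have hfM' : ∀ j ≤ k + 1, ∀ x ∈ Icc a b, |iteratedDerivWithin j h (Icc a b) x| ≤ M := by
      intro j hj x hx
      rw [hh_def, ← iteratedDerivWithin_succ']
      exact hfM (j + 1) (by omega) (by omega) x hx
    have huB := hquot h u hh hu hf1 hfM' fun j hj x hx ↦ by
      rw [iteratedDerivWithin_congr hhu hx]
      exact hψM j hj x hx
    have ha : a ∈ Icc a b := left_mem_Icc.2 hab.le
    have hua := iteratedDerivWithin_eq_zero_of_smul hS hh hu ha (h0 a ha) fun j hj ↦ by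
      rw [iteratedDerivWithin_congr hhu ha]
      exact hψa j hj
    have h1le : (1 : WithTop ℕ∞) ≤ (k + 1 : ℕ) := by exact_mod_cast Nat.le_add_left 1 k
    have hparts := mul_integral_cpow_mul_derivWithin_smul hab hM
      (hf.of_le (by exact_mod_cast Nat.le_add_left 1 (k + 1))) hfb hf1
      (fun x hx ↦ (le_abs_self _).trans (hfM' 0 (Nat.zero_le _) x hx)) (hu.of_le h1le)
      (by simpa using hua 0 (Nat.zero_le _)) (z := z) (by rwa [hz])
    have hcongr : ∫ x in a..b, ((-f x : ℝ) : ℂ) ^ z * (h x • u x) =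
        ∫ x in a..b, ((-f x : ℝ) : ℂ) ^ z * ψ x := by
      refine intervalIntegral.integral_congr fun x hx ↦ ?_
      rw [uIcc_of_le hab.le] at hx
      have := hhu hx
      simp only [Pi.smul_apply'] at this
      simp only [this]
    rw [← hh_def, hcongr] at hparts
    have hdecay := ih f (derivWithin u (Icc a b))
      (hf.of_le (by exact_mod_cast Nat.le_succ (k + 1))) hfb hf1
      (fun j h1 h2 x hx ↦ le_max_of_le_left (hfM j h1 (by omega) x hx))
      (hu.derivWithin hS (by norm_cast))
      (fun j hj x hx ↦ by
        rw [← iteratedDerivWithin_succ']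
        exact le_max_of_le_right (huB (j + 1) (by omega) x hx))
      (fun j hj ↦ by
        rw [← iteratedDerivWithin_succ']
        exact hua (j + 1) (by omega))
      (z + 1) (by simp [hz])
    rw [← hparts, norm_mul] at hdecay
    have him : |z.im| ≤ ‖z + 1‖ := by simpa using Complex.abs_im_le_norm (z + 1)
    have him' : (z + 1).im = z.im := by simp
    rw [him'] at hdecay
    calc _ = |z.im| * (‖∫ x in a..b, ((-f x : ℝ) : ℂ) ^ z * ψ x‖ * |z.im| ^ k) := by ring
      _ ≤ ‖z + 1‖ * (‖∫ x in a..b, ((-f x : ℝ) : ℂ) ^ z * ψ x‖ * |z.im| ^ k) := by gcongr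
      _ ≤ C := by rw [← mul_assoc]; exact hdecay

theorem integral_rpowC_mul_eq (hab : a ≤ b) (hf : DifferentiableOn ℝ f (Icc a b)) (hfb : f b = 0)
    (hf1 : ∀ x ∈ Icc a b, 1 ≤ derivWithin f (Icc a b) x) (ψ : ℝ → ℂ) (z : ℂ) :
    ∫ x in a..b, rpowC |f x| z * ψ x = ∫ x in a..b, ((-f x : ℝ) : ℂ) ^ z * ψ x := by
  refine intervalIntegral.integral_congr_ae ?_
  rw [← ae_restrict_iff' measurableSet_uIoc]
  filter_upwards [ae_mem_Ioo_restrict_uIoc hab] with x hx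
  have hpos : 0 < -f x := (sub_pos.2 hx.2).trans_le
    (sub_le_neg_of_one_le_derivWithin hf hfb hf1 (Ioo_subset_Icc_self hx))
  rw [rpowC, abs_of_neg (neg_pos.1 hpos), Complex.cpow_def_of_ne_zero
    (Complex.ofReal_ne_zero.2 hpos.ne'), Complex.ofReal_log hpos.le, mul_comm z]

end Oscillatory

/-- Appendix A.2: uniform rapid decay of the scaled `J⁻`-integral.
Given `k` and `M`, finitely many derivative bounds (of some order `n = n(k)`) on the
phase `f` and the amplitude `ψ` suffice for the bound `C·|λ|^{−k}`, uniformly in the data. -/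
theorem scaled_J_minus_bound (k : ℕ) (M : ℝ) (hM : 1 ≤ M) :
    ∃ n : ℕ, ∃ C : ℝ, 0 < C ∧
      ∀ f : ℝ → ℝ, ∀ ψ : ℝ → ℂ,
        ContDiffOn ℝ n f (Set.Icc (1 / 4 : ℝ) 1) →
        f 1 = 0 →
        (∀ x ∈ Set.Icc (1 / 4 : ℝ) 1,
          1 ≤ iteratedDerivWithin 1 f (Set.Icc (1 / 4 : ℝ) 1) x) →
        (∀ j : ℕ, 1 ≤ j → j ≤ n → ∀ x ∈ Set.Icc (1 / 4 : ℝ) 1,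
          |iteratedDerivWithin j f (Set.Icc (1 / 4 : ℝ) 1) x| ≤ M) →
        ContDiffOn ℝ n ψ (Set.Icc (1 / 4 : ℝ) 1) →
        (∀ j : ℕ, j ≤ n → ∀ x ∈ Set.Icc (1 / 4 : ℝ) 1,
          ‖iteratedDerivWithin j ψ (Set.Icc (1 / 4 : ℝ) 1) x‖ ≤ M) →
        (∀ j : ℕ, j ≤ n →
          iteratedDerivWithin j ψ (Set.Icc (1 / 4 : ℝ) 1) (1 / 4) = 0) →
        ∀ lam : ℂ, lam.re = 0 → 1 ≤ ‖lam‖ →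
          ‖∫ x in (1 / 4 : ℝ)..1, rpowC |f x| ((lam - 1) / 2) * ψ x‖ ≤
            C * ‖lam‖ ^ (-(k : ℝ)) := by
  obtain ⟨C, hC⟩ := exists_norm_integral_cpow_mul_le (a := 1 / 4) (b := 1) (by norm_num) k M
    (by linarith) (-1 / 2) (by norm_num)
  refine ⟨k + 1, max C 1 * 2 ^ k, by positivity, ?_⟩
  intro f ψ hf hf1 hf' hfM hψ hψM hψ0 lam hre hlam
  simp only [iteratedDerivWithin_one] at hf'
  rw [integral_rpowC_mul_eq (by norm_num) (hf.differentiableOn (by simp)) hf1 hf']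
  have key := hC f ψ hf hf1 hf' hfM (hψ.of_le (by exact_mod_cast k.le_succ))
    (fun j hj ↦ hψM j (by omega)) (fun j hj ↦ hψ0 j (by omega)) ((lam - 1) / 2) (by simp [hre])
  have him : |((lam - 1) / 2).im| = ‖lam‖ / 2 := by
    rw [← Complex.abs_im_eq_norm.2 hre]
    simp [abs_div]
  have hpos : 0 < ‖lam‖ := by linarith
  rw [him, div_pow, mul_div_assoc', div_le_iff₀ (by positivity)] at key
  rw [Real.rpow_neg hpos.le, Real.rpow_natCast, ← div_eq_mul_inv, le_div_iff₀ (by positivity)]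
  exact key.trans (by gcongr; exact le_max_left _ _)
end

section
/- (Reduction identity for the ♭-transform of the test function, Section 3.6.) For all real numbers N ≥ T ≥ 1 and all purely imaginary s: w^♭_{N,T}(s) = (1/2)·(∫_ℝ ψ(v) dv)·T^{(1+s)/2}·∫_ℝ ψ(t)·e^{i(N/T)t}·|t|^{−(1+s)/2} dt, where T^{(1+s)/2} := exp(((1+s)/2)·log T). -/
open MeasureTheory

/-- `w^♭(s) = ∫_{ℝ²} w(x,y)·|x−y|^{(−s−1)/2} dx dy`. -/
noncomputable def flatW (w : ℝ × ℝ → ℂ) (s : ℂ) : ℂ :=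
  ∫ p : ℝ × ℝ, w p * rpowC |p.1 - p.2| ((-s - 1) / 2)

/-- Change of variables `(u, v) = (x - y, x + y)` on the plane, for a product integrand. -/
theorem integral_sub_mul_add (f g : ℝ → ℂ) :
    ∫ p : ℝ × ℝ, f (p.1 - p.2) * g (p.1 + p.2) = (1 / 2) * ((∫ u, f u) * ∫ v, g v) := by
  let L : ℝ × ℝ →L[ℝ] ℝ × ℝ := LinearMap.toContinuousLinearMap
    (Matrix.toLin (Module.Basis.finTwoProd ℝ) (Module.Basis.finTwoProd ℝ) !![1, -1; 1, 1])
  have hL : ∀ p : ℝ × ℝ, L p = (p.1 - p.2, p.1 + p.2) := fun p => by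
    simp [L, Matrix.toLin_finTwoProd_apply, sub_eq_add_neg]
  have hdet : L.det = 2 := by
    simp only [L, LinearMap.det_toContinuousLinearMap, LinearMap.det_toLin, Matrix.det_fin_two_of]
    norm_num
  have hinj : Function.Injective L := by
    intro p q h
    rw [hL, hL, Prod.mk.injEq] at h
    ext <;> linarith [h.1, h.2]
  have hsurj : Function.Surjective L := fun q =>
    ⟨((q.1 + q.2) / 2, (q.2 - q.1) / 2), by rw [hL]; ext <;> ring⟩
  have key := integral_image_eq_integral_abs_det_fderiv_smul volume MeasurableSet.univ
    (fun x _ => L.hasFDerivWithinAt) hinj.injOn (fun q : ℝ × ℝ => f q.1 * g q.2)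
  rw [Set.image_univ, hsurj.range_eq, Measure.restrict_univ, Measure.volume_eq_prod,
    integral_prod_mul, integral_smul] at key
  simp only [hdet, hL, Complex.real_smul] at key
  rw [key, Measure.volume_eq_prod, abs_two, Complex.ofReal_ofNat]
  ring

/-- Multiplicativity of `rpowC |·| z` under scaling by a positive number. -/
theorem rpowC_abs_mul {T : ℝ} (hT : 0 < T) {u : ℝ} (hu : u ≠ 0) (z : ℂ) :
    rpowC |T * u| z = Complex.exp (z * (Real.log T : ℂ)) * rpowC |u| z := by
  rw [rpowC, rpowC, ← Complex.exp_add, abs_mul, abs_of_pos hT,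
    Real.log_mul hT.ne' (abs_ne_zero.mpr hu)]
  push_cast
  ring_nf

/-- Reduction identity for the ♭-transform of the test function (Section 3.6):
`w^♭_{N,T}(s) = (1/2)·(∫ψ)·T^{(1+s)/2}·∫ ψ(t)·e^{i(N/T)t}·|t|^{−(1+s)/2} dt`. -/
theorem flat_transform_reduction
    (χ : ℝ → ℂ) (hχ_smooth : ContDiff ℝ (⊤ : ℕ∞) χ)
    (hχ_supp : Function.support χ ⊆ Set.Icc (-(1 / 8) : ℝ) (1 / 8))
    (hχ_fourier : ∀ ξ : ℝ, |ξ| ≤ 1 →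
      1 ≤ ‖∫ x : ℝ, χ x * Complex.exp (-Complex.I * (ξ : ℂ) * (x : ℂ))‖)
    (ψ : ℝ → ℂ)
    (hψ : ∀ x : ℝ, ψ x = ∫ y : ℝ, χ y * (starRingEnd ℂ) (χ (y - x)))
    (w : ℝ → ℝ → ℝ × ℝ → ℂ)
    (hw : ∀ N T : ℝ, ∀ p : ℝ × ℝ, w N T p =
      (T : ℂ) * Complex.exp (Complex.I * (N : ℂ) * ((p.1 : ℂ) - (p.2 : ℂ))) *
        ψ (T * (p.1 - p.2)) * ψ (p.1 + p.2)) :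
    ∀ N T : ℝ, 1 ≤ T → T ≤ N → ∀ s : ℂ, s.re = 0 →
      flatW (w N T) s =
        (1 / 2) * (∫ v : ℝ, ψ v) * Complex.exp (((1 + s) / 2) * (Real.log T : ℂ)) *
          ∫ t : ℝ, ψ t * Complex.exp (Complex.I * ((N / T : ℝ) : ℂ) * (t : ℂ)) *
            rpowC |t| (-((1 + s) / 2)) := by
  intro N T hT _ s _
  have hT0 : 0 < T := one_pos.trans_le hT
  have hTC : (T : ℂ) ≠ 0 := Complex.ofReal_ne_zero.mpr hT0.ne'
  set G : ℝ → ℂ := fun t => ψ t * Complex.exp (Complex.I * ((N / T : ℝ) : ℂ) * (t : ℂ)) *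
    rpowC |t| (-((1 + s) / 2)) with hG
  set c : ℂ := Complex.exp (((1 + s) / 2) * (Real.log T : ℂ)) with hc
  let f : ℝ → ℂ := fun u => (T : ℂ) * Complex.exp (Complex.I * (N : ℂ) * (u : ℂ)) *
    ψ (T * u) * rpowC |u| ((-s - 1) / 2)
  have hflat : flatW (w N T) s = ∫ p : ℝ × ℝ, f (p.1 - p.2) * ψ (p.1 + p.2) := by
    refine integral_congr_ae (Filter.Eventually.of_forall fun p => ?_)
    simp only [hw, f, Complex.ofReal_sub]
    ring
  have hf : ∫ u, f u = c * ∫ t, G t := by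
    have hae : f =ᵐ[volume] fun u => (T : ℂ) * c * G (T * u) := by
      filter_upwards [Measure.ae_ne volume (0 : ℝ)] with u hu
      have hcinv : c * Complex.exp (-((1 + s) / 2) * (Real.log T : ℂ)) = 1 := by
        rw [hc, ← Complex.exp_add, neg_mul, add_neg_cancel, Complex.exp_zero]
      have hphase : Complex.I * ((N / T : ℝ) : ℂ) * ((T * u : ℝ) : ℂ) =
          Complex.I * (N : ℂ) * (u : ℂ) := by
        push_cast
        field_simp
      have hexp : (-s - 1) / 2 = -((1 + s) / 2) := by ring
      simp only [f, hG]
      rw [rpowC_abs_mul hT0 hu, hphase, hexp]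
      linear_combination -(T : ℂ) * Complex.exp (Complex.I * (N : ℂ) * (u : ℂ)) *
        ψ (T * u) * rpowC |u| (-((1 + s) / 2)) * hcinv
    rw [integral_congr_ae hae, integral_const_mul, Measure.integral_comp_mul_left G T,
      abs_of_pos (inv_pos.mpr hT0), Complex.real_smul]
    push_cast
    field_simp
  rw [hflat, integral_sub_mul_add, hf]
  ring
end
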